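/- Assume P satisfies power-law ψ-mixing with exponent α > 0, and let g₁, g₂ : Ω → ℂ be quasi-local with rate r. Then there exists a constant C such that for all integers n ≥ 1 one has | E[ (g₁∘S^n)·g₂ ] − E(g₁)·E(g₂) | ≤ C·n^{−α}. In particular, for a bounded centered quasi-local potential V : Ω → ℝ there is a constant C with |E[ V·(V∘S^n) ]| ≤ C·|n|^{−α} for all n ≠ 0. -/

import Mathlib

open MeasureTheory Filter

noncomputable section

attribute [local instance] Matrix.normedAddCommGroup Matrix.normedSpace

/-- The shift by `n` on the configuration space `Σ^ℤ`: `(shiftn n ω) i = ω (i + n)`.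
`shiftn 1` is the left shift `S`. -/
def shiftn {A : Type*} (n : ℤ) (ω : ℤ → A) : ℤ → A := fun i => ω (i + n)

/-- A bounded function `g` on `Σ^ℤ` is quasi-local with rate `r` if its variation on the
window `[-m, n]` is bounded by `C(g) · r^(min m n)` for all `m, n ≥ 1`. -/
def QuasiLocal {A : Type*} {E : Type*} [SeminormedAddGroup E] (r : ℝ)
    (g : (ℤ → A) → E) : Prop :=
  ∃ C : ℝ, ∀ m n : ℕ, 1 ≤ m → 1 ≤ n → ∀ ω ω' : ℤ → A,
    (∀ i : ℤ, -(m : ℤ) ≤ i → i ≤ (n : ℤ) → ω i = ω' i) →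
    ‖g ω - g ω'‖ ≤ C * r ^ (min m n)

/-- Power-law ψ-mixing with exponent α: for all `k < l < m < n`, all bounded `g₁` measurable
w.r.t. the coordinates in `[k,l]` and bounded `g₂` measurable w.r.t. the coordinates in `[m,n]`,
`|E(g₁g₂) − E(g₁)E(g₂)| ≤ C·E(|g₁|)·E(|g₂|)·|m−l|^(−α)`. -/
def PowerMixing {A : Type*} [MeasurableSpace A] (P : Measure (ℤ → A)) (α : ℝ) : Prop :=
  ∃ C : ℝ, ∀ k l m n : ℤ, k < l → l < m → m < n →
    ∀ g₁ g₂ : (ℤ → A) → ℝ, Measurable g₁ → Measurable g₂ →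
      (∃ B, ∀ ω, |g₁ ω| ≤ B) → (∃ B, ∀ ω, |g₂ ω| ≤ B) →
      (∀ ω ω', (∀ i : ℤ, k ≤ i → i ≤ l → ω i = ω' i) → g₁ ω = g₁ ω') →
      (∀ ω ω', (∀ i : ℤ, m ≤ i → i ≤ n → ω i = ω' i) → g₂ ω = g₂ ω') →
      |(∫ ω, g₁ ω * g₂ ω ∂P) - (∫ ω, g₁ ω ∂P) * ∫ ω, g₂ ω ∂P| ≤
        C * (∫ ω, |g₁ ω| ∂P) * (∫ ω, |g₂ ω| ∂P) * (|(m : ℝ) - (l : ℝ)|) ^ (-α)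

/-- The transfer matrix `T^E_{λ,ω} = [[E − λV(ω), −1],[1, 0]]`. -/
def transferMat {A : Type*} (lam : ℝ) (V : (ℤ → A) → ℝ) (E : ℂ) (ω : ℤ → A) :
    Matrix (Fin 2) (Fin 2) ℂ :=
  !![E - (lam : ℂ) * (V ω : ℂ), -1; 1, 0]

/-- The product `T^E_{λ,S^Nω} ⋯ T^E_{λ,S²ω} T^E_{λ,Sω}` of transfer matrices. -/
def transferProd {A : Type*} (lam : ℝ) (V : (ℤ → A) → ℝ) (E : ℂ) :
    ℕ → (ℤ → A) → Matrix (Fin 2) (Fin 2) ℂ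
  | 0, _ => 1
  | n + 1, ω => transferMat lam V E (shiftn (n + 1) ω) * transferProd lam V E n ω

/-- `γ` is the Lyapunov exponent at energy `E`:
`γ = lim_{N→∞} (1/N)·E log‖T^E_{λ,S^Nω}⋯T^E_{λ,Sω}‖`. -/
def IsLyapunov {A : Type*} [MeasurableSpace A] (P : Measure (ℤ → A)) (lam : ℝ)
    (V : (ℤ → A) → ℝ) (E : ℂ) (γ : ℝ) : Prop :=
  Tendsto (fun N : ℕ => (N : ℝ)⁻¹ * ∫ ω, Real.log ‖transferProd lam V E N ω‖ ∂P)
    atTop (nhds γ)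

/-- The spectral density `D_V(k) = Σ_{n∈ℤ} e^{ikn} E(V·(V∘S^n))`. -/
def specDensity {A : Type*} [MeasurableSpace A] (P : Measure (ℤ → A))
    (V : (ℤ → A) → ℝ) (k : ℝ) : ℂ :=
  ∑' n : ℤ, Complex.exp (Complex.I * (k : ℂ) * (n : ℂ)) *
    ((∫ ω, V ω * V (shiftn n ω) ∂P : ℝ) : ℂ)

/-- The distance from `k` to the nearest point of `(π/2)·ℤ`. -/
def distHalfPi (k : ℝ) : ℝ := ⨅ j : ℤ, |k - Real.pi / 2 * (j : ℝ)|

section Shift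

variable {A : Type*}

lemma shiftn_shiftn (m n : ℤ) (ω : ℤ → A) : shiftn m (shiftn n ω) = shiftn (m + n) ω := by
  funext i
  simp only [shiftn]
  congr 1
  ring

lemma shiftn_zero (ω : ℤ → A) : shiftn 0 ω = ω := by
  funext i
  simp [shiftn]

variable [MeasurableSpace A]

lemma measurable_shiftn (n : ℤ) : Measurable (shiftn n : (ℤ → A) → ℤ → A) :=
  measurable_pi_lambda _ fun i => measurable_pi_apply (i + n)

lemma measurePreserving_shiftn_natCast {P : Measure (ℤ → A)}
    (hinv : MeasurePreserving (shiftn 1) P P) (n : ℕ) :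
    MeasurePreserving (shiftn (n : ℤ)) P P := by
  induction n with
  | zero =>
    have h : (shiftn ((0 : ℕ) : ℤ) : (ℤ → A) → ℤ → A) = id := funext shiftn_zero
    rw [h]
    exact MeasurePreserving.id P
  | succ k ih =>
    have h : (shiftn ((k + 1 : ℕ) : ℤ) : (ℤ → A) → ℤ → A) = shiftn (k : ℤ) ∘ shiftn 1 := by
      funext ω
      simp [shiftn_shiftn]
    rw [h]
    exact ih.comp hinv

lemma integral_comp_shiftn {P : Measure (ℤ → A)}
    (hinv : MeasurePreserving (shiftn 1) P P) (n : ℕ) {E : Type*}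
    [NormedAddCommGroup E] [NormedSpace ℝ E] [MeasurableSpace E] [BorelSpace E]
    [SecondCountableTopology E] {f : (ℤ → A) → E} (hf : Measurable f) :
    ∫ ω, f (shiftn n ω) ∂P = ∫ ω, f ω ∂P := by
  have h := measurePreserving_shiftn_natCast hinv n
  conv_rhs => rw [← h.map_eq]
  exact (integral_map h.measurable.aemeasurable hf.aestronglyMeasurable).symm

end Shift

section Truncation

variable {A : Type*}

/-- The configuration that agrees with `ω` on `[-N, N]` and is constant equal to `a` outside. -/
def truncate (a : A) (N : ℕ) (ω : ℤ → A) : ℤ → A :=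
  fun i => if -(N : ℤ) ≤ i ∧ i ≤ N then ω i else a

lemma measurable_truncate [MeasurableSpace A] (a : A) (N : ℕ) : Measurable (truncate a N) := by
  refine measurable_pi_lambda _ fun i => ?_
  by_cases h : -(N : ℤ) ≤ i ∧ i ≤ N
  · simpa only [truncate, if_pos h] using measurable_pi_apply i
  · simpa only [truncate, if_neg h] using measurable_const

lemma truncate_congr (a : A) (N : ℕ) {ω ω' : ℤ → A}
    (h : ∀ i : ℤ, -(N : ℤ) ≤ i → i ≤ N → ω i = ω' i) : truncate a N ω = truncate a N ω' := by
  funext i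
  simp only [truncate]
  split_ifs with hi
  · exact h i hi.1 hi.2
  · rfl

lemma QuasiLocal.exists_abs_sub_truncate_le {r : ℝ} {g : (ℤ → A) → ℝ} (hr : 0 < r)
    (hg : QuasiLocal r g) :
    ∃ C : ℝ, 0 ≤ C ∧ ∀ (a : A) (N : ℕ), 1 ≤ N → ∀ ω,
      |g ω - g (truncate a N ω)| ≤ C * r ^ N := by
  obtain ⟨C, hC⟩ := hg
  refine ⟨|C|, abs_nonneg C, fun a N hN ω => ?_⟩
  have h := hC N N hN hN ω (truncate a N ω) fun i h₁ h₂ => by simp [truncate, h₁, h₂]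
  rw [min_self, Real.norm_eq_abs] at h
  exact h.trans (mul_le_mul_of_nonneg_right (le_abs_self C) (by positivity))

end Truncation

section Covariance

variable {Ω : Type*} [MeasurableSpace Ω]

lemma Measurable.integrable_of_forall_norm_le {E : Type*} [NormedAddCommGroup E]
    [MeasurableSpace E] [BorelSpace E] [SecondCountableTopology E]
    {P : Measure Ω} [IsFiniteMeasure P] {f : Ω → E} {B : ℝ}
    (hf : Measurable f) (hB : ∀ ω, ‖f ω‖ ≤ B) : Integrable f P :=
  Integrable.of_bound hf.aestronglyMeasurable B (Eventually.of_forall hB)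

lemma abs_integral_le_of_forall_abs_le {P : Measure Ω} [IsProbabilityMeasure P] {f : Ω → ℝ}
    {B : ℝ} (hB : ∀ ω, |f ω| ≤ B) : |∫ ω, f ω ∂P| ≤ B := by
  simpa using norm_integral_le_of_norm_le_const (μ := P) (f := f) (Eventually.of_forall hB)

lemma abs_mul_sub_mul_le {a b c d B₁ B₂ ε₁ ε₂ : ℝ} (ha : |a| ≤ B₁) (hd : |d| ≤ B₂)
    (hac : |a - c| ≤ ε₁) (hbd : |b - d| ≤ ε₂) :
    |a * b - c * d| ≤ B₁ * ε₂ + B₂ * ε₁ := by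
  have h : a * b - c * d = a * (b - d) + d * (a - c) := by ring
  rw [h]
  refine (abs_add_le _ _).trans ?_
  rw [abs_mul, abs_mul]
  have := (abs_nonneg a).trans ha
  have := (abs_nonneg d).trans hd
  gcongr

lemma abs_covariance_sub_covariance_le {P : Measure Ω} [IsProbabilityMeasure P]
    {F G f g : Ω → ℝ} {B₁ B₂ ε₁ ε₂ : ℝ}
    (hF : Measurable F) (hG : Measurable G) (hf : Measurable f) (hg : Measurable g)
    (hFB : ∀ ω, |F ω| ≤ B₁) (hGB : ∀ ω, |G ω| ≤ B₂)
    (hfB : ∀ ω, |f ω| ≤ B₁) (hgB : ∀ ω, |g ω| ≤ B₂)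
    (hFf : ∀ ω, |F ω - f ω| ≤ ε₁) (hGg : ∀ ω, |G ω - g ω| ≤ ε₂) :
    |((∫ ω, F ω * G ω ∂P) - (∫ ω, F ω ∂P) * ∫ ω, G ω ∂P) -
      ((∫ ω, f ω * g ω ∂P) - (∫ ω, f ω ∂P) * ∫ ω, g ω ∂P)| ≤
      2 * (B₁ * ε₂ + B₂ * ε₁) := by
  have iF := hF.integrable_of_forall_norm_le (P := P) hFB
  have iG := hG.integrable_of_forall_norm_le (P := P) hGB
  have jf := hf.integrable_of_forall_norm_le (P := P) hfB
  have jg := hg.integrable_of_forall_norm_le (P := P) hgB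
  have mul_bound : ∀ {u v : Ω → ℝ}, (∀ ω, |u ω| ≤ B₁) → (∀ ω, |v ω| ≤ B₂) →
      ∀ ω, ‖u ω * v ω‖ ≤ B₁ * B₂ := fun hu hv ω => by
    rw [norm_mul]
    exact mul_le_mul (hu ω) (hv ω) (norm_nonneg _) ((abs_nonneg _).trans (hu ω))
  have iFG := (hF.mul hG).integrable_of_forall_norm_le (P := P) (mul_bound hFB hGB)
  have jfg := (hf.mul hg).integrable_of_forall_norm_le (P := P) (mul_bound hfB hgB)
  have h₁ : |(∫ ω, F ω * G ω ∂P) - ∫ ω, f ω * g ω ∂P| ≤ B₁ * ε₂ + B₂ * ε₁ := by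
    have e : (∫ ω, F ω * G ω ∂P) - ∫ ω, f ω * g ω ∂P = ∫ ω, (F ω * G ω - f ω * g ω) ∂P :=
      (integral_sub iFG jfg).symm
    rw [e]
    exact abs_integral_le_of_forall_abs_le fun ω =>
      abs_mul_sub_mul_le (hFB ω) (hgB ω) (hFf ω) (hGg ω)
  have h₂ : |(∫ ω, F ω ∂P) * (∫ ω, G ω ∂P) - (∫ ω, f ω ∂P) * ∫ ω, g ω ∂P| ≤
      B₁ * ε₂ + B₂ * ε₁ := by
    refine abs_mul_sub_mul_le (abs_integral_le_of_forall_abs_le hFB)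
      (abs_integral_le_of_forall_abs_le hgB) ?_ ?_
    · rw [← integral_sub iF jf]
      exact abs_integral_le_of_forall_abs_le hFf
    · rw [← integral_sub iG jg]
      exact abs_integral_le_of_forall_abs_le hGg
  rw [abs_le] at h₁ h₂ ⊢
  constructor <;> linarith [h₁.1, h₁.2, h₂.1, h₂.2]

end Covariance

lemma exists_pow_div_four_le_rpow_neg {r : ℝ} (hr : 0 < r) (hr1 : r < 1) (α : ℝ) :
    ∃ K : ℝ, 0 ≤ K ∧ ∀ n : ℕ, 1 ≤ n → r ^ (n / 4) ≤ K * (n : ℝ) ^ (-α) := by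
  have hb : 0 < -Real.log r / 4 := by linarith [Real.log_neg hr hr1]
  have ht := (tendsto_rpow_mul_exp_neg_mul_atTop_nhds_zero α _ hb).comp
    (tendsto_natCast_atTop_atTop (R := ℝ))
  obtain ⟨M, hM⟩ := ht.bddAbove_range
  have hM' : ∀ n : ℕ, (n : ℝ) ^ α * Real.exp (-(-Real.log r / 4) * n) ≤ M :=
    fun n => hM ⟨n, rfl⟩
  have hM0 : 0 ≤ M := le_trans (by positivity) (hM' 1)
  refine ⟨r⁻¹ * M, by positivity, fun n hn => ?_⟩
  have hn0 : (0 : ℝ) < n := by exact_mod_cast hn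
  have hfloor : (n : ℝ) / 4 - 1 ≤ ((n / 4 : ℕ) : ℝ) := by
    have h : n ≤ 4 * (n / 4) + 4 := by omega
    have h' : (n : ℝ) ≤ 4 * ((n / 4 : ℕ) : ℝ) + 4 := by exact_mod_cast h
    linarith
  have hexp : r ^ ((n : ℝ) / 4 - 1) = r⁻¹ * Real.exp (-(-Real.log r / 4) * n) := by
    rw [Real.rpow_sub hr, Real.rpow_one, Real.rpow_def_of_pos hr, div_eq_inv_mul]
    congr 2
    ring
  calc r ^ (n / 4) = r ^ (((n / 4 : ℕ) : ℝ)) := (Real.rpow_natCast _ _).symm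
    _ ≤ r ^ ((n : ℝ) / 4 - 1) := Real.rpow_le_rpow_of_exponent_ge hr hr1.le hfloor
    _ = r⁻¹ * ((n : ℝ) ^ α * Real.exp (-(-Real.log r / 4) * n)) * (n : ℝ) ^ (-α) := by
        have hc : (n : ℝ) ^ α * (n : ℝ) ^ (-α) = 1 := by
          rw [← Real.rpow_add hn0, add_neg_cancel, Real.rpow_zero]
        rw [hexp]
        linear_combination (-(r⁻¹ * Real.exp (-(-Real.log r / 4) * n))) * hc
    _ ≤ r⁻¹ * M * (n : ℝ) ^ (-α) := by
        gcongr
        exact hM' n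

lemma QuasiLocal.re {A : Type*} {r : ℝ} {g : (ℤ → A) → ℂ} (hg : QuasiLocal r g) :
    QuasiLocal r fun ω => (g ω).re := by
  obtain ⟨C, hC⟩ := hg
  refine ⟨C, fun m n hm hn ω ω' h => le_trans ?_ (hC m n hm hn ω ω' h)⟩
  rw [Real.norm_eq_abs, ← Complex.sub_re]
  exact Complex.abs_re_le_norm _

lemma QuasiLocal.im {A : Type*} {r : ℝ} {g : (ℤ → A) → ℂ} (hg : QuasiLocal r g) :
    QuasiLocal r fun ω => (g ω).im := by
  obtain ⟨C, hC⟩ := hg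
  refine ⟨C, fun m n hm hn ω ω' h => le_trans ?_ (hC m n hm hn ω ω' h)⟩
  rw [Real.norm_eq_abs, ← Complex.sub_im]
  exact Complex.abs_im_le_norm _

/-- The mixing estimate for the truncations of two bounded observables to `[-N, N]`, one of them
shifted by `n`. -/
lemma PowerMixing.exists_truncate_covariance_le {A : Type*} [MeasurableSpace A]
    {P : Measure (ℤ → A)} [IsProbabilityMeasure P] {α : ℝ} (hα : 0 < α) (hmix : PowerMixing P α)
    {g₁ g₂ : (ℤ → A) → ℝ} (hg₁ : Measurable g₁) (hg₂ : Measurable g₂) {B₁ B₂ : ℝ}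
    (hB₁ : ∀ ω, |g₁ ω| ≤ B₁) (hB₂ : ∀ ω, |g₂ ω| ≤ B₂) :
    ∃ K : ℝ, ∀ (a : A) (n N : ℕ), 1 ≤ N → 4 * N ≤ n →
      |(∫ ω, g₁ (truncate a N (shiftn n ω)) * g₂ (truncate a N ω) ∂P) -
        (∫ ω, g₁ (truncate a N (shiftn n ω)) ∂P) * ∫ ω, g₂ (truncate a N ω) ∂P| ≤
        K * (n : ℝ) ^ (-α) := by
  obtain ⟨C, hC⟩ := hmix
  refine ⟨|C| * B₂ * B₁ * (1 / 2) ^ (-α), fun a n N hN hn => ?_⟩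
  have hNn : 4 * (N : ℝ) ≤ n := by exact_mod_cast hn
  have hN0 : (1 : ℝ) ≤ N := by exact_mod_cast hN
  have hn0 : (0 : ℝ) < n := by linarith
  have h := hC (-N) N (n - N) (n + N) (by omega) (by omega) (by omega)
    (fun ω => g₂ (truncate a N ω)) (fun ω => g₁ (truncate a N (shiftn n ω)))
    (hg₂.comp (measurable_truncate a N))
    (hg₁.comp ((measurable_truncate a N).comp (measurable_shiftn n)))
    ⟨B₂, fun ω => hB₂ _⟩ ⟨B₁, fun ω => hB₁ _⟩
    (fun ω ω' h => congrArg g₂ (truncate_congr a N h))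
    (fun ω ω' h => congrArg g₁ (truncate_congr a N fun i h₁ h₂ =>
      h (i + n) (by omega) (by omega)))
  have hint₁ : ∫ ω, |g₁ (truncate a N (shiftn n ω))| ∂P ≤ B₁ :=
    (le_abs_self _).trans (abs_integral_le_of_forall_abs_le fun ω => by
      rw [abs_abs]; exact hB₁ _)
  have hint₂ : ∫ ω, |g₂ (truncate a N ω)| ∂P ≤ B₂ :=
    (le_abs_self _).trans (abs_integral_le_of_forall_abs_le fun ω => by
      rw [abs_abs]; exact hB₂ _)
  have hi₁ : 0 ≤ ∫ ω, |g₁ (truncate a N (shiftn n ω))| ∂P :=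
    integral_nonneg fun ω => abs_nonneg _
  have hi₂ : 0 ≤ ∫ ω, |g₂ (truncate a N ω)| ∂P := integral_nonneg fun ω => abs_nonneg _
  have hB₁0 := hi₁.trans hint₁
  have hB₂0 := hi₂.trans hint₂
  have hdist : |(((n - N : ℤ)) : ℝ) - ((N : ℤ) : ℝ)| ^ (-α) ≤
      (1 / 2) ^ (-α) * (n : ℝ) ^ (-α) := by
    rw [← Real.mul_rpow (by norm_num) hn0.le]
    refine Real.rpow_le_rpow_of_nonpos (by positivity) ?_ (by linarith)
    refine le_trans ?_ (le_abs_self _)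
    push_cast
    linarith
  simp only [mul_comm (g₂ _) (g₁ _)] at h
  rw [mul_comm (∫ ω, g₂ (truncate a N ω) ∂P) (∫ ω, g₁ (truncate a N (shiftn n ω)) ∂P)] at h
  refine h.trans ?_
  rw [mul_assoc (|C| * B₂ * B₁)]
  gcongr
  exact le_abs_self C

lemma PowerMixing.exists_real_covariance_le {A : Type*} [MeasurableSpace A]
    {P : Measure (ℤ → A)} [IsProbabilityMeasure P]
    (hinv : MeasurePreserving (shiftn 1) P P) {r : ℝ} (hr : 0 < r) (hr1 : r < 1)
    {α : ℝ} (hα : 0 < α) (hmix : PowerMixing P α)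
    {g₁ g₂ : (ℤ → A) → ℝ} (hg₁ : Measurable g₁) (hg₂ : Measurable g₂)
    (hg₁bdd : ∃ B, ∀ ω, |g₁ ω| ≤ B) (hg₂bdd : ∃ B, ∀ ω, |g₂ ω| ≤ B)
    (hg₁ql : QuasiLocal r g₁) (hg₂ql : QuasiLocal r g₂) :
    ∃ C : ℝ, ∀ n : ℕ, 1 ≤ n →
      |(∫ ω, g₁ (shiftn n ω) * g₂ ω ∂P) - (∫ ω, g₁ ω ∂P) * ∫ ω, g₂ ω ∂P| ≤
        C * (n : ℝ) ^ (-α) := by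
  obtain ⟨ω₀⟩ : Nonempty (ℤ → A) := nonempty_of_isProbabilityMeasure P
  obtain ⟨B₁, hB₁⟩ := hg₁bdd
  obtain ⟨B₂, hB₂⟩ := hg₂bdd
  have hB₁0 : 0 ≤ B₁ := (abs_nonneg _).trans (hB₁ ω₀)
  have hB₂0 : 0 ≤ B₂ := (abs_nonneg _).trans (hB₂ ω₀)
  obtain ⟨C₁, hC₁0, hC₁⟩ := hg₁ql.exists_abs_sub_truncate_le hr
  obtain ⟨C₂, hC₂0, hC₂⟩ := hg₂ql.exists_abs_sub_truncate_le hr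
  obtain ⟨K, hK⟩ := hmix.exists_truncate_covariance_le hα hg₁ hg₂ hB₁ hB₂
  obtain ⟨R, hR0, hR⟩ := exists_pow_div_four_le_rpow_neg hr hr1 α
  refine ⟨max (K + 2 * (B₁ * C₂ + B₂ * C₁) * R) (2 * (B₁ * B₂) * R), fun n hn => ?_⟩
  rw [← integral_comp_shiftn hinv n hg₁]
  have hn0 : (0 : ℝ) ≤ (n : ℝ) ^ (-α) := by positivity
  rcases lt_or_ge n 4 with h4 | h4
  · refine le_trans ?_ (mul_le_mul_of_nonneg_right (le_max_right _ _) hn0)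
    have hone : 1 ≤ R * (n : ℝ) ^ (-α) := by
      simpa [Nat.div_eq_of_lt h4] using hR n hn
    have h₁ : |∫ ω, g₁ (shiftn n ω) * g₂ ω ∂P| ≤ B₁ * B₂ :=
      abs_integral_le_of_forall_abs_le fun ω => by
        rw [abs_mul]
        exact mul_le_mul (hB₁ _) (hB₂ _) (abs_nonneg _) hB₁0
    have h₂ : |(∫ ω, g₁ (shiftn n ω) ∂P) * ∫ ω, g₂ ω ∂P| ≤ B₁ * B₂ := by
      rw [abs_mul]
      exact mul_le_mul (abs_integral_le_of_forall_abs_le fun ω => hB₁ _)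
        (abs_integral_le_of_forall_abs_le hB₂) (abs_nonneg _) hB₁0
    calc |(∫ ω, g₁ (shiftn n ω) * g₂ ω ∂P) - (∫ ω, g₁ (shiftn n ω) ∂P) * ∫ ω, g₂ ω ∂P|
        ≤ B₁ * B₂ + B₁ * B₂ := (abs_sub _ _).trans (add_le_add h₁ h₂)
      _ = 2 * (B₁ * B₂) * 1 := by ring
      _ ≤ 2 * (B₁ * B₂) * (R * (n : ℝ) ^ (-α)) := by gcongr
      _ = 2 * (B₁ * B₂) * R * (n : ℝ) ^ (-α) := by ring
  · refine le_trans ?_ (mul_le_mul_of_nonneg_right (le_max_left _ _) hn0)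
    have hN : 1 ≤ n / 4 := by omega
    have hlocal := hK (ω₀ 0) n (n / 4) hN (by omega)
    have happrox := abs_covariance_sub_covariance_le (P := P)
      (hg₁.comp (measurable_shiftn n)) hg₂
      (hg₁.comp ((measurable_truncate (ω₀ 0) (n / 4)).comp (measurable_shiftn n)))
      (hg₂.comp (measurable_truncate (ω₀ 0) (n / 4)))
      (fun ω => hB₁ _) hB₂ (fun ω => hB₁ _) (fun ω => hB₂ _)
      (fun ω => hC₁ (ω₀ 0) (n / 4) hN (shiftn n ω)) (hC₂ (ω₀ 0) (n / 4) hN)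
    simp only [Function.comp_apply] at happrox
    have hrate : 2 * (B₁ * (C₂ * r ^ (n / 4)) + B₂ * (C₁ * r ^ (n / 4))) ≤
        2 * (B₁ * C₂ + B₂ * C₁) * R * (n : ℝ) ^ (-α) := by
      calc 2 * (B₁ * (C₂ * r ^ (n / 4)) + B₂ * (C₁ * r ^ (n / 4)))
          = 2 * (B₁ * C₂ + B₂ * C₁) * r ^ (n / 4) := by ring
        _ ≤ 2 * (B₁ * C₂ + B₂ * C₁) * (R * (n : ℝ) ^ (-α)) := by
            gcongr
            exact hR n hn
        _ = 2 * (B₁ * C₂ + B₂ * C₁) * R * (n : ℝ) ^ (-α) := by ring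
    rw [add_mul]
    rw [abs_le] at happrox hlocal ⊢
    constructor <;> linarith [happrox.1, happrox.2, hlocal.1, hlocal.2]

/-- The covariance of two complex observables in terms of those of their real and imaginary
parts. -/
lemma norm_complex_covariance_le {Ω : Type*} [MeasurableSpace Ω] {P : Measure Ω}
    [IsProbabilityMeasure P] {F G : Ω → ℂ} {B₁ B₂ : ℝ} (hF : Measurable F) (hG : Measurable G)
    (hFB : ∀ ω, ‖F ω‖ ≤ B₁) (hGB : ∀ ω, ‖G ω‖ ≤ B₂) :
    ‖(∫ ω, F ω * G ω ∂P) - (∫ ω, F ω ∂P) * ∫ ω, G ω ∂P‖ ≤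
      |(∫ ω, (F ω).re * (G ω).re ∂P) - (∫ ω, (F ω).re ∂P) * ∫ ω, (G ω).re ∂P| +
      |(∫ ω, (F ω).im * (G ω).im ∂P) - (∫ ω, (F ω).im ∂P) * ∫ ω, (G ω).im ∂P| +
      |(∫ ω, (F ω).re * (G ω).im ∂P) - (∫ ω, (F ω).re ∂P) * ∫ ω, (G ω).im ∂P| +
      |(∫ ω, (F ω).im * (G ω).re ∂P) - (∫ ω, (F ω).im ∂P) * ∫ ω, (G ω).re ∂P| := by
  have iF := hF.integrable_of_forall_norm_le (P := P) hFB
  have iG := hG.integrable_of_forall_norm_le (P := P) hGB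
  have prod_integrable : ∀ {u v : Ω → ℝ}, Measurable u → Measurable v →
      (∀ ω, |u ω| ≤ B₁) → (∀ ω, |v ω| ≤ B₂) → Integrable (fun ω => u ω * v ω) P :=
    fun hu hv hub hvb => (hu.mul hv).integrable_of_forall_norm_le (B := B₁ * B₂) fun ω => by
      simp only [norm_mul]
      exact mul_le_mul (hub ω) (hvb ω) (norm_nonneg _) ((abs_nonneg _).trans (hub ω))
  have iFG : Integrable (fun ω => F ω * G ω) P :=
    (hF.mul hG).integrable_of_forall_norm_le (B := B₁ * B₂) fun ω => by
      simp only [norm_mul]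
      exact mul_le_mul (hFB ω) (hGB ω) (norm_nonneg _) ((norm_nonneg _).trans (hFB ω))
  have mFr : Measurable fun ω => (F ω).re := Complex.measurable_re.comp hF
  have mFi : Measurable fun ω => (F ω).im := Complex.measurable_im.comp hF
  have mGr : Measurable fun ω => (G ω).re := Complex.measurable_re.comp hG
  have mGi : Measurable fun ω => (G ω).im := Complex.measurable_im.comp hG
  have bFr : ∀ ω, |(F ω).re| ≤ B₁ := fun ω => (Complex.abs_re_le_norm _).trans (hFB ω)
  have bFi : ∀ ω, |(F ω).im| ≤ B₁ := fun ω => (Complex.abs_im_le_norm _).trans (hFB ω)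
  have bGr : ∀ ω, |(G ω).re| ≤ B₂ := fun ω => (Complex.abs_re_le_norm _).trans (hGB ω)
  have bGi : ∀ ω, |(G ω).im| ≤ B₂ := fun ω => (Complex.abs_im_le_norm _).trans (hGB ω)
  have re_integral : ∀ {f : Ω → ℂ}, Integrable f P → (∫ ω, f ω ∂P).re = ∫ ω, (f ω).re ∂P :=
    fun hf => (integral_re (𝕜 := ℂ) hf).symm
  have im_integral : ∀ {f : Ω → ℂ}, Integrable f P → (∫ ω, f ω ∂P).im = ∫ ω, (f ω).im ∂P :=
    fun hf => (integral_im (𝕜 := ℂ) hf).symm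
  refine (Complex.norm_le_abs_re_add_abs_im _).trans ?_
  rw [Complex.sub_re, Complex.sub_im, Complex.mul_re, Complex.mul_im, re_integral iFG,
    im_integral iFG, re_integral iF, im_integral iF, re_integral iG, im_integral iG]
  simp only [Complex.mul_re, Complex.mul_im]
  rw [integral_sub (prod_integrable mFr mGr bFr bGr) (prod_integrable mFi mGi bFi bGi),
    integral_add (prod_integrable mFr mGi bFr bGi) (prod_integrable mFi mGr bFi bGr),
    add_assoc (|_| + |_|), sub_sub_sub_comm, add_sub_add_comm]
  exact add_le_add (abs_sub _ _) (abs_add_le _ _)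

/-- Decay of correlations of quasi-local functions under power-law ψ-mixing; in particular,
a bounded centered quasi-local potential satisfies `|E(V·(V∘S^n))| ≤ C·|n|^{−α}`. -/
theorem quasiLocal_correlation_decay {A : Type*} [Countable A] [MeasurableSpace A]
    (P : Measure (ℤ → A)) [IsProbabilityMeasure P]
    (hinv : MeasurePreserving (shiftn 1) P P)
    (r : ℝ) (hr : 0 < r) (hr1 : r < 1)
    (α : ℝ) (hα : 0 < α) (hmix : PowerMixing P α)
    (g₁ g₂ : (ℤ → A) → ℂ) (hg₁meas : Measurable g₁) (hg₂meas : Measurable g₂)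
    (hg₁bdd : ∃ B, ∀ ω, ‖g₁ ω‖ ≤ B) (hg₂bdd : ∃ B, ∀ ω, ‖g₂ ω‖ ≤ B)
    (hg₁ql : QuasiLocal r g₁) (hg₂ql : QuasiLocal r g₂) :
    (∃ C : ℝ, ∀ n : ℕ, 1 ≤ n →
      ‖(∫ ω, g₁ (shiftn n ω) * g₂ ω ∂P) - (∫ ω, g₁ ω ∂P) * ∫ ω, g₂ ω ∂P‖ ≤
        C * (n : ℝ) ^ (-α)) ∧
    (∀ V : (ℤ → A) → ℝ, Measurable V → (∃ B, ∀ ω, |V ω| ≤ B) → QuasiLocal r V →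
      (∫ ω, V ω ∂P) = 0 →
      ∃ C : ℝ, ∀ n : ℤ, n ≠ 0 →
        |∫ ω, V ω * V (shiftn n ω) ∂P| ≤ C * |(n : ℝ)| ^ (-α)) := by
  refine ⟨?_, fun V hV hVbdd hVql hV0 => ?_⟩
  · obtain ⟨B₁, hB₁⟩ := hg₁bdd
    obtain ⟨B₂, hB₂⟩ := hg₂bdd
    have mr₁ : Measurable fun ω => (g₁ ω).re := Complex.measurable_re.comp hg₁meas
    have mi₁ : Measurable fun ω => (g₁ ω).im := Complex.measurable_im.comp hg₁meas
    have mr₂ : Measurable fun ω => (g₂ ω).re := Complex.measurable_re.comp hg₂meas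
    have mi₂ : Measurable fun ω => (g₂ ω).im := Complex.measurable_im.comp hg₂meas
    have br₁ : ∃ B, ∀ ω, |(g₁ ω).re| ≤ B :=
      ⟨B₁, fun ω => (Complex.abs_re_le_norm _).trans (hB₁ ω)⟩
    have bi₁ : ∃ B, ∀ ω, |(g₁ ω).im| ≤ B :=
      ⟨B₁, fun ω => (Complex.abs_im_le_norm _).trans (hB₁ ω)⟩
    have br₂ : ∃ B, ∀ ω, |(g₂ ω).re| ≤ B :=
      ⟨B₂, fun ω => (Complex.abs_re_le_norm _).trans (hB₂ ω)⟩
    have bi₂ : ∃ B, ∀ ω, |(g₂ ω).im| ≤ B :=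
      ⟨B₂, fun ω => (Complex.abs_im_le_norm _).trans (hB₂ ω)⟩
    obtain ⟨Crr, hrr⟩ := hmix.exists_real_covariance_le hinv hr hr1 hα mr₁ mr₂ br₁ br₂
      hg₁ql.re hg₂ql.re
    obtain ⟨Cii, hii⟩ := hmix.exists_real_covariance_le hinv hr hr1 hα mi₁ mi₂ bi₁ bi₂
      hg₁ql.im hg₂ql.im
    obtain ⟨Cri, hri⟩ := hmix.exists_real_covariance_le hinv hr hr1 hα mr₁ mi₂ br₁ bi₂
      hg₁ql.re hg₂ql.im
    obtain ⟨Cir, hir⟩ := hmix.exists_real_covariance_le hinv hr hr1 hα mi₁ mr₂ bi₁ br₂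
      hg₁ql.im hg₂ql.re
    refine ⟨Crr + Cii + Cri + Cir, fun n hn => ?_⟩
    rw [← integral_comp_shiftn hinv n hg₁meas]
    refine (norm_complex_covariance_le (hg₁meas.comp (measurable_shiftn n)) hg₂meas
      (fun ω => hB₁ _) hB₂).trans ?_
    simp only [Function.comp_apply]
    rw [integral_comp_shiftn hinv n mr₁, integral_comp_shiftn hinv n mi₁, add_mul, add_mul,
      add_mul]
    exact add_le_add (add_le_add (add_le_add (hrr n hn) (hii n hn)) (hri n hn)) (hir n hn)
  · obtain ⟨C, hC⟩ := hmix.exists_real_covariance_le hinv hr hr1 hα hV hV hVbdd hVbdd hVql hVql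
    refine ⟨C, fun n hn => ?_⟩
    have hcorr : ∫ ω, V ω * V (shiftn n ω) ∂P = ∫ ω, V (shiftn n.natAbs ω) * V ω ∂P := by
      rcases le_total 0 n with h | h
      · rw [Int.natAbs_of_nonneg h]
        exact integral_congr_ae (Eventually.of_forall fun ω => mul_comm _ _)
      · have hprod : Measurable fun ω => V ω * V (shiftn n ω) :=
          hV.mul (hV.comp (measurable_shiftn n))
        rw [← integral_comp_shiftn hinv n.natAbs hprod]
        simp only [shiftn_shiftn, Int.ofNat_natAbs_of_nonpos h, add_neg_cancel, shiftn_zero]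
    have hnat := hC n.natAbs (by omega)
    rwa [hV0, zero_mul, sub_zero, ← hcorr, Nat.cast_natAbs, Int.cast_abs] at hnat
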